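/- Under the same assumptions, for every x ∈ D := closure(D(A)) (not just x ∈ D(A)), the function u(t) := U(t)x is a solution of u'' + ((1-2α)/t)u' = Au on (0,∞) with u(0) = x; that is, u ∈ C_b([0,∞);D) ∩ C²((0,∞);D), u(t) ∈ D(A) for t > 0, and the ODE holds. -/

import Mathlib

open MeasureTheory Set Filter Topology

/-- The kernel `r ^ β * exp (-s / r)`, for real `r` and complex `β`. -/
noncomputable def invExpKernel (β : ℂ) (s r : ℝ) : ℂ :=
  (r : ℂ) ^ β * (Real.exp (-s / r) : ℂ)

/-- The integral of `S` over `(0, ∞)` against the kernel `r ^ β * exp (-s / r)`. -/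
noncomputable def invExpIntegral {X : Type*} [NormedAddCommGroup X] [NormedSpace ℂ X]
    (S : ℝ → X) (β : ℂ) (s : ℝ) : X :=
  ∫ r in Ioi (0 : ℝ), invExpKernel β s r • S r

theorem integrableOn_rpow_mul_exp_neg_div {b c : ℝ} (hb : b < -1) (hc : 0 < c) :
    IntegrableOn (fun r : ℝ => r ^ b * Real.exp (-c / r)) (Ioi 0) := by
  have h := integrableOn_rpow_mul_exp_neg_mul_rpow (p := 1) (s := -b - 2) (b := c)
    (by linarith) one_pos hc
  rw [← integrableOn_Ioi_comp_rpow_iff' _ (by norm_num : (-1 : ℝ) ≠ 0)] at h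
  refine h.congr_fun (fun r hr => ?_) measurableSet_Ioi
  have hr : 0 < r := hr
  simp only [smul_eq_mul, Real.rpow_one, Real.rpow_neg_one]
  rw [← mul_assoc, Real.inv_rpow hr.le, ← Real.rpow_neg hr.le, ← Real.rpow_add hr]
  congr 2
  ring

theorem norm_invExpKernel (β : ℂ) (s : ℝ) {r : ℝ} (hr : 0 < r) :
    ‖invExpKernel β s r‖ = r ^ β.re * Real.exp (-s / r) := by
  rw [invExpKernel, norm_mul, Complex.norm_cpow_eq_rpow_re_of_pos hr, Complex.norm_real,
    Real.norm_of_nonneg (Real.exp_pos _).le]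

theorem hasDerivAt_invExpKernel {β : ℂ} (hβ : β ≠ 0) (s : ℝ) {r : ℝ} (hr : 0 < r) :
    HasDerivAt (invExpKernel β s)
      (β * invExpKernel (β - 1) s r + s * invExpKernel (β - 2) s r) r := by
  have h1 := hasDerivAt_ofReal_cpow_const hr.ne' hβ
  have h2 : HasDerivAt (fun r : ℝ => -s / r) (s / r ^ 2) r := by
    have := (hasDerivAt_inv hr.ne').const_mul (-s)
    refine (this.congr_deriv ?_)
    field_simp
  have h3 := h1.mul h2.exp.ofReal_comp
  refine h3.congr_deriv ?_
  have hr' : (r : ℂ) ≠ 0 := by exact_mod_cast hr.ne'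
  have h4 : (r : ℂ) ^ (β - 2) = (r : ℂ) ^ β / r ^ 2 := by
    rw [Complex.cpow_sub _ _ hr']; norm_cast
  simp only [invExpKernel, h4]
  push_cast
  field_simp

theorem continuousOn_invExpKernel (β : ℂ) (s : ℝ) :
    ContinuousOn (invExpKernel β s) (Ioi 0) := by
  intro r hr
  have hr : 0 < r := hr
  refine ContinuousAt.continuousWithinAt (ContinuousAt.mul ?_ ?_)
  · exact Complex.continuousAt_ofReal_cpow_const _ _ (Or.inr hr.ne')
  · have : ContinuousAt (fun r : ℝ => Real.exp (-s / r)) r :=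
      (continuousAt_const.div continuousAt_id hr.ne').rexp
    exact Complex.continuous_ofReal.continuousAt.comp this

theorem hasDerivAt_invExpKernel_param (β : ℂ) (s : ℝ) {r : ℝ} (hr : 0 < r) :
    HasDerivAt (fun s => invExpKernel β s r) (-invExpKernel (β - 1) s r) s := by
  have h2 : HasDerivAt (fun s : ℝ => -s / r) (-1 / r) s :=
    (hasDerivAt_id s).neg.div_const r
  refine (h2.exp.ofReal_comp.const_mul ((r : ℂ) ^ β)).congr_deriv ?_
  have hr' : (r : ℂ) ≠ 0 := by exact_mod_cast hr.ne'
  simp only [invExpKernel, Complex.cpow_sub _ _ hr', Complex.cpow_one]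
  push_cast
  field_simp

theorem tendsto_invExpKernel_zero (β : ℂ) {s : ℝ} (hs : 0 < s) :
    Tendsto (invExpKernel β s) (𝓝[>] 0) (𝓝 0) := by
  rw [tendsto_zero_iff_norm_tendsto_zero]
  have h := (tendsto_rpow_mul_exp_neg_mul_atTop_nhds_zero (-β.re) s hs).comp
    tendsto_inv_nhdsGT_zero
  refine h.congr' ?_
  filter_upwards [self_mem_nhdsWithin] with r hr
  have hr : 0 < r := hr
  rw [norm_invExpKernel _ _ hr, Function.comp_apply, Real.inv_rpow hr.le, Real.rpow_neg hr.le,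
    inv_inv, div_eq_mul_inv]

section

variable {X : Type*} [NormedAddCommGroup X] [NormedSpace ℂ X]

theorem aestronglyMeasurable_invExpKernel_smul {S : ℝ → X} (hS : ContinuousOn S (Ici 0))
    (β : ℂ) (s : ℝ) :
    AEStronglyMeasurable (fun r => invExpKernel β s r • S r) (volume.restrict (Ioi 0)) :=
  ((continuousOn_invExpKernel β s).smul (hS.mono Ioi_subset_Ici_self)).aestronglyMeasurable
    measurableSet_Ioi

theorem integrableOn_invExpKernel_smul {S : ℝ → X} (hS : ContinuousOn S (Ici 0))
    {C : ℝ} (hC : ∀ r, 0 ≤ r → ‖S r‖ ≤ C) {β : ℂ} (hβ : β.re < -1) {s : ℝ} (hs : 0 < s) :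
    IntegrableOn (fun r => invExpKernel β s r • S r) (Ioi 0) := by
  refine ((integrableOn_rpow_mul_exp_neg_div hβ hs).mul_const C).mono'
    (aestronglyMeasurable_invExpKernel_smul hS β s) ?_
  filter_upwards [ae_restrict_mem measurableSet_Ioi] with r hr
  rw [norm_smul, norm_invExpKernel _ _ hr]
  have hr : 0 < r := hr
  gcongr
  exact hC r hr.le

theorem hasDerivAt_invExpIntegral {S : ℝ → X} (hS : ContinuousOn S (Ici 0))
    {C : ℝ} (hC : ∀ r, 0 ≤ r → ‖S r‖ ≤ C) {β : ℂ} (hβ : β.re < -1) {s : ℝ} (hs : 0 < s) :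
    HasDerivAt (invExpIntegral S β) (-invExpIntegral S (β - 1) s) s := by
  have hβ' : (β - 1).re < -1 := by simp; linarith
  have key := (hasDerivAt_integral_of_dominated_loc_of_deriv_le
    (μ := volume.restrict (Ioi (0 : ℝ)))
    (F := fun s r => invExpKernel β s r • S r)
    (F' := fun s r => -(invExpKernel (β - 1) s r • S r)) (x₀ := s)
    (bound := fun r => r ^ (β - 1).re * Real.exp (-(s / 2) / r) * C)
    (Ioi_mem_nhds (half_lt_self hs))
    (Eventually.of_forall fun s => aestronglyMeasurable_invExpKernel_smul hS β s)
    (integrableOn_invExpKernel_smul hS hC hβ hs)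
    (aestronglyMeasurable_invExpKernel_smul hS (β - 1) s).neg ?_
    ((integrableOn_rpow_mul_exp_neg_div hβ' (half_pos hs)).mul_const C) ?_).2
  · rw [integral_neg] at key
    exact key
  · filter_upwards [ae_restrict_mem measurableSet_Ioi] with r hr s' hs'
    rw [norm_neg, norm_smul, norm_invExpKernel _ _ hr]
    have hr : 0 < r := hr
    have hs' : s / 2 < s' := hs'
    gcongr
    exact hC r hr.le
  · filter_upwards [ae_restrict_mem measurableSet_Ioi] with r hr s' hs'
    rw [← neg_smul]
    exact (hasDerivAt_invExpKernel_param β s' hr).smul_const (S r)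

theorem invExpIntegral_add_smul_of_hasDerivAt [CompleteSpace X] {S S' : ℝ → X}
    (hS : ContinuousOn S (Ici 0)) {C : ℝ} (hC : ∀ r, 0 ≤ r → ‖S r‖ ≤ C)
    (hS' : ContinuousOn S' (Ici 0)) {C' : ℝ} (hC' : ∀ r, 0 ≤ r → ‖S' r‖ ≤ C')
    (hd : ∀ r, 0 < r → HasDerivAt S (S' r) r)
    {β : ℂ} (hβ : β.re < -1) {s : ℝ} (hs : 0 < s) :
    β • invExpIntegral S (β - 1) s + (s : ℂ) • invExpIntegral S (β - 2) s =
      -invExpIntegral S' β s := by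
  have hβ1 : (β - 1).re < -1 := by simp; linarith
  have hβ2 : (β - 2).re < -1 := by simp; linarith
  have hβ0 : β ≠ 0 := by rintro rfl; norm_num at hβ
  have i0 := integrableOn_invExpKernel_smul hS hC hβ hs
  have i1 : IntegrableOn (fun r => β • (invExpKernel (β - 1) s r • S r)) (Ioi 0) :=
    (integrableOn_invExpKernel_smul hS hC hβ1 hs).smul β
  have i2 : IntegrableOn (fun r => (s : ℂ) • (invExpKernel (β - 2) s r • S r)) (Ioi 0) :=
    (integrableOn_invExpKernel_smul hS hC hβ2 hs).smul (s : ℂ)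
  have i3 := integrableOn_invExpKernel_smul hS' hC' hβ hs
  have hderiv : ∀ r ∈ Ioi (0 : ℝ), HasDerivAt (fun r => invExpKernel β s r • S r)
      (invExpKernel β s r • S' r + (β • (invExpKernel (β - 1) s r • S r) +
        (s : ℂ) • (invExpKernel (β - 2) s r • S r))) r := by
    intro r hr
    refine ((hasDerivAt_invExpKernel hβ0 s hr).smul (hd r hr)).congr_deriv ?_
    simp only [add_smul, smul_smul]
  have i12 : IntegrableOn (fun r => β • (invExpKernel (β - 1) s r • S r) +
      (s : ℂ) • (invExpKernel (β - 2) s r • S r)) (Ioi 0) := i1.add i2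
  have iT := i3.add i12
  have hcont : ContinuousWithinAt (fun r => invExpKernel β s r • S r) (Ici 0) 0 := by
    rw [← continuousWithinAt_Ioi_iff_Ici]
    have h := (tendsto_invExpKernel_zero β hs).smul
      ((hS 0 self_mem_Ici).mono Ioi_subset_Ici_self).tendsto
    simpa [ContinuousWithinAt, invExpKernel, hβ0] using h
  have key := integral_Ioi_of_hasDerivAt_of_tendsto hcont hderiv iT
    (tendsto_zero_of_hasDerivAt_of_integrableOn_Ioi hderiv iT i0)
  have h0 : invExpKernel β s 0 = 0 := by simp [invExpKernel, hβ0]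
  rw [integral_add i3 i12, integral_add i1 i2, integral_smul, integral_smul,
    h0, zero_smul, sub_zero] at key
  rw [eq_neg_iff_add_eq_zero, add_comm]
  exact key

theorem invExpIntegral_eq_gamma_subordination (S : ℝ → X) (α : ℂ) {s : ℝ} (hs : 0 < s) :
    invExpIntegral S (-α - 1) s = (s : ℂ) ^ (-α) •
      ∫ ρ in Ioi (0 : ℝ), ((Real.exp (-ρ) : ℂ) * (ρ : ℂ) ^ (α - 1)) • S (s / ρ) := by
  have hs' : (s : ℂ) ≠ 0 := by exact_mod_cast hs.ne'
  rw [invExpIntegral, ← integral_comp_rpow_Ioi _ (by norm_num : (-1 : ℝ) ≠ 0)]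
  have h := integral_comp_mul_left_Ioi' (fun x : ℝ => (|(-1 : ℝ)| * x ^ (-1 - 1 : ℝ)) •
    invExpKernel (-α - 1) s (x ^ (-1 : ℝ)) • S (x ^ (-1 : ℝ))) 0 (inv_pos.2 hs)
  rw [mul_zero] at h
  rw [← h, ← integral_smul, ← integral_smul]
  refine setIntegral_congr_fun measurableSet_Ioi fun ρ hρ => ?_
  have hρ : 0 < ρ := hρ
  have hρ' : (ρ : ℂ) ≠ 0 := by exact_mod_cast hρ.ne'
  have e1 : (s⁻¹ * ρ) ^ (-1 : ℝ) = s / ρ := by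
    rw [Real.rpow_neg_one]; field_simp
  have e2 : (s⁻¹ * ρ) ^ (-1 - 1 : ℝ) = (s / ρ) ^ 2 := by
    rw [show (-1 - 1 : ℝ) = (-1) * (2 : ℕ) by norm_num, Real.rpow_mul (by positivity), e1,
      Real.rpow_natCast]
  have e3 : ((s / ρ : ℝ) : ℂ) ^ (-α - 1) = (s : ℂ) ^ (-α) / s * ((ρ : ℂ) ^ α * ρ) := by
    have h := Complex.mul_cpow_ofReal_nonneg (div_pos hs hρ).le hρ.le (-α - 1)
    rw [← Complex.ofReal_mul, div_mul_cancel₀ _ hρ.ne', Complex.cpow_sub _ _ hs',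
      Complex.cpow_sub _ _ hρ', Complex.cpow_one, Complex.cpow_one] at h
    have hρα : (ρ : ℂ) ^ α ≠ 0 := fun h0 => hρ' ((Complex.cpow_eq_zero_iff _ _).1 h0).1
    rw [h, Complex.cpow_neg (ρ : ℂ) α]
    field_simp
  have e4 : -s / (s / ρ) = -ρ := by field_simp
  simp only [e1, e2, e4, invExpKernel, e3, ← Complex.coe_smul, smul_smul,
    Complex.cpow_sub _ _ hρ', Complex.cpow_one]
  congr 1
  push_cast
  simp
  field_simp

theorem hasDerivAt_cpow_smul_invExpIntegral {S : ℝ → X} (hS : ContinuousOn S (Ici 0))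
    {C : ℝ} (hC : ∀ r, 0 ≤ r → ‖S r‖ ≤ C) (γ : ℂ) {β : ℂ} (hβ : β.re < -1) {t : ℝ}
    (ht : 0 < t) :
    HasDerivAt (fun t : ℝ => (t : ℂ) ^ γ • invExpIntegral S β (t ^ 2 / 4))
      (γ • (t : ℂ) ^ (γ - 1) • invExpIntegral S β (t ^ 2 / 4) +
        (-1 / 2 : ℂ) • (t : ℂ) ^ (γ + 1) • invExpIntegral S (β - 1) (t ^ 2 / 4)) t := by
  have ht' : (t : ℂ) ≠ 0 := by exact_mod_cast ht.ne'
  have h1 : HasDerivAt (fun t : ℝ => (t : ℂ) ^ γ) (γ * (t : ℂ) ^ (γ - 1)) t := by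
    rcases eq_or_ne γ 0 with rfl | hγ
    · simpa using hasDerivAt_const t (1 : ℂ)
    · exact hasDerivAt_ofReal_cpow_const ht.ne' hγ
  have h2 : HasDerivAt (fun t : ℝ => t ^ 2 / 4) (t / 2) t := by
    refine ((hasDerivAt_pow 2 t).div_const 4).congr_deriv ?_
    norm_num
    ring
  have h3 := (hasDerivAt_invExpIntegral hS hC hβ (by positivity : 0 < t ^ 2 / 4)).scomp t h2
  refine (h1.smul h3).congr_deriv ?_
  rw [add_comm, Complex.cpow_add _ _ ht', Complex.cpow_one, ← Complex.coe_smul]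
  simp only [smul_smul, smul_neg, ← neg_smul]
  congr 2
  push_cast
  ring

theorem contDiffOn_cpow_smul_invExpIntegral {S : ℝ → X} (hS : ContinuousOn S (Ici 0))
    {C : ℝ} (hC : ∀ r, 0 ≤ r → ‖S r‖ ≤ C) (n : ℕ) (γ : ℂ) {β : ℂ} (hβ : β.re < -1) :
    ContDiffOn ℝ n (fun t : ℝ => (t : ℂ) ^ γ • invExpIntegral S β (t ^ 2 / 4)) (Ioi 0) := by
  induction n generalizing γ β with
  | zero =>
    exact contDiffOn_zero.2 fun t ht =>
      (hasDerivAt_cpow_smul_invExpIntegral hS hC γ hβ ht).continuousAt.continuousWithinAt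
  | succ n ih =>
    push_cast
    rw [contDiffOn_succ_iff_deriv_of_isOpen isOpen_Ioi]
    refine ⟨fun t ht => (hasDerivAt_cpow_smul_invExpIntegral hS hC γ hβ
      ht).differentiableAt.differentiableWithinAt, by simp, ?_⟩
    have hβ1 : (β - 1).re < -1 := by simp; linarith
    exact (((ih (γ - 1) hβ).const_smul γ).add
      ((ih (γ + 1) hβ1).const_smul (-1 / 2 : ℂ))).congr fun t ht =>
        (hasDerivAt_cpow_smul_invExpIntegral hS hC γ hβ ht).deriv

theorem deriv_deriv_cpow_smul_invExpIntegral {S : ℝ → X} (hS : ContinuousOn S (Ici 0))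
    {C : ℝ} (hC : ∀ r, 0 ≤ r → ‖S r‖ ≤ C) {α : ℂ} (hα : 0 < α.re) {t : ℝ} (ht : 0 < t) :
    deriv (deriv fun t : ℝ => (t : ℂ) ^ (2 * α) • invExpIntegral S (-α - 1) (t ^ 2 / 4)) t +
      ((1 - 2 * α) / (t : ℂ)) •
        deriv (fun t : ℝ => (t : ℂ) ^ (2 * α) • invExpIntegral S (-α - 1) (t ^ 2 / 4)) t =
    (t : ℂ) ^ (2 * α) • ((-α - 1) • invExpIntegral S (-α - 1 - 1) (t ^ 2 / 4) +
      ((t ^ 2 / 4 : ℝ) : ℂ) • invExpIntegral S (-α - 1 - 2) (t ^ 2 / 4)) := by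
  have ht' : (t : ℂ) ≠ 0 := by exact_mod_cast ht.ne'
  have hβ : (-α - 1).re < -1 := by simp; linarith
  have hβ1 : (-α - 1 - 1).re < -1 := by simp; linarith
  have hd {t : ℝ} (ht : 0 < t) :=
    hasDerivAt_cpow_smul_invExpIntegral hS hC (2 * α) hβ ht
  have hdd := ((hasDerivAt_cpow_smul_invExpIntegral hS hC (2 * α - 1) hβ ht).const_smul
    (2 * α)).add ((hasDerivAt_cpow_smul_invExpIntegral hS hC (2 * α + 1) hβ1 ht).const_smul
    (-1 / 2 : ℂ))
  have he : (deriv fun t : ℝ => (t : ℂ) ^ (2 * α) • invExpIntegral S (-α - 1) (t ^ 2 / 4))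
      =ᶠ[𝓝 t] ((2 * α) • fun t : ℝ =>
          (t : ℂ) ^ (2 * α - 1) • invExpIntegral S (-α - 1) (t ^ 2 / 4)) +
        (-1 / 2 : ℂ) • fun t : ℝ =>
          (t : ℂ) ^ (2 * α + 1) • invExpIntegral S (-α - 1 - 1) (t ^ 2 / 4) := by
    filter_upwards [Ioi_mem_nhds ht] with t ht using (hd ht).deriv
  rw [(hdd.congr_of_eventuallyEq he).deriv, (hd ht).deriv,
    show -α - 1 - 1 - 1 = -α - 1 - 2 by ring]
  simp only [Complex.cpow_sub _ _ ht', Complex.cpow_add _ _ ht', Complex.cpow_one]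
  match_scalars
  · field_simp
    ring
  · field_simp
    ring
  · field_simp
    ring

end

section

variable {X : Type*} [NormedAddCommGroup X] [NormedSpace ℂ X] {A : X →ₗ.[ℂ] X}
  {T : ℝ → X →L[ℂ] X}

theorem mem_closure_domain_of_hasDerivAt
    (hTD : ∀ t : ℝ, 0 ≤ t → ∀ y ∈ closure (A.domain : Set X),
      T t y ∈ closure (A.domain : Set X))
    (hT0 : ∀ y ∈ closure (A.domain : Set X), T 0 y = y)
    (hgen : ∀ x : A.domain, ∀ t : ℝ, 0 ≤ t →
      ∃ hm : T t (x : X) ∈ A.domain,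
        HasDerivAt (fun s => T s (x : X)) (-(A ⟨T t (x : X), hm⟩)) t) (x : A.domain) :
    A x ∈ closure (A.domain : Set X) := by
  obtain ⟨hm, hd⟩ := hgen x 0 le_rfl
  have hx : T 0 (x : X) = x := hT0 _ (subset_closure x.2)
  have e : (⟨T 0 (x : X), hm⟩ : A.domain) = x := Subtype.ext hx
  rw [e] at hd
  have h := isClosed_closure.mem_of_tendsto hd.tendsto_slope_zero_right
    (b := 𝓝[>] (0 : ℝ)) (s := closure (A.domain : Set X)) ?_
  · rw [← Submodule.topologicalClosure_coe] at h ⊢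
    exact neg_mem_iff.1 h
  · filter_upwards [self_mem_nhdsWithin] with t ht
    have ht : 0 < t := ht
    have h1 := hTD t ht.le _ (subset_closure x.2)
    have h2 := hTD 0 le_rfl _ (subset_closure x.2)
    rw [← Submodule.topologicalClosure_coe] at h1 h2 ⊢
    rw [zero_add]
    exact Submodule.smul_of_tower_mem _ _ (sub_mem h1 h2)

theorem apply_semigroup_eq_semigroup_apply
    (hT0 : ∀ y ∈ closure (A.domain : Set X), T 0 y = y)
    (hsemi : ∀ s t : ℝ, 0 ≤ s → 0 ≤ t → ∀ y ∈ closure (A.domain : Set X),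
      T (s + t) y = T s (T t y))
    (hgen : ∀ x : A.domain, ∀ t : ℝ, 0 ≤ t →
      ∃ hm : T t (x : X) ∈ A.domain,
        HasDerivAt (fun s => T s (x : X)) (-(A ⟨T t (x : X), hm⟩)) t)
    (x : A.domain) {t : ℝ} (ht : 0 ≤ t) (hm : T t (x : X) ∈ A.domain) :
    A ⟨T t (x : X), hm⟩ = T t (A x) := by
  obtain ⟨hm0, hd0⟩ := hgen x 0 le_rfl
  have hx : T 0 (x : X) = x := hT0 _ (subset_closure x.2)
  have e : (⟨T 0 (x : X), hm0⟩ : A.domain) = x := Subtype.ext hx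
  rw [e] at hd0
  obtain ⟨_, hd⟩ := hgen x t ht
  have h1 := ((T t).continuous.tendsto _).comp hd0.tendsto_slope_zero_right
  have h2 := tendsto_nhds_unique (h1.congr' ?_) hd.tendsto_slope_zero_right
  · simpa using h2.symm
  · filter_upwards [self_mem_nhdsWithin] with s hs
    have hs : 0 < s := hs
    simp only [Function.comp_apply, zero_add]
    rw [hsemi t s ht hs.le _ (subset_closure x.2), hx, ← Complex.coe_smul, ← Complex.coe_smul,
      map_smul, map_sub]

theorem apply_invExpIntegral_orbit [CompleteSpace X] {R : X →L[ℂ] X} {C : ℝ}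
    (hR : ∀ y : X, ∃ h : R y ∈ A.domain, A ⟨R y, h⟩ + R y = y)
    (hRinv : ∀ x : A.domain, R (A x + (x : X)) = x)
    (hcont : ∀ y, ContinuousOn (fun t => T t y) (Ici 0))
    (hbdd : ∀ t : ℝ, 0 ≤ t → ∀ y, ‖T t y‖ ≤ C * ‖y‖)
    (hmem : ∀ x : A.domain, ∀ t : ℝ, 0 ≤ t → T t (x : X) ∈ A.domain)
    (hcomm : ∀ x : A.domain, ∀ t : ℝ, ∀ ht : 0 ≤ t, A ⟨T t (x : X), hmem x t ht⟩ = T t (A x))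
    (hderiv : ∀ x : A.domain, ∀ t : ℝ, 0 ≤ t →
      HasDerivAt (fun s => T s (x : X)) (-T t (A x)) t)
    {β : ℂ} (hβ : β.re < -1) {s : ℝ} (hs : 0 < s) (x : X) :
    ∃ h : invExpIntegral (fun r => T r x) β s ∈ A.domain,
      A ⟨invExpIntegral (fun r => T r x) β s, h⟩ =
        β • invExpIntegral (fun r => T r x) (β - 1) s +
          (s : ℂ) • invExpIntegral (fun r => T r x) (β - 2) s := by
  have hβ1 : (β - 1).re < -1 := by simp; linarith
  have hβ2 : (β - 2).re < -1 := by simp; linarith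
  have hint : ∀ (y : X) {δ : ℂ}, δ.re < -1 →
      IntegrableOn (fun r => invExpKernel δ s r • T r y) (Ioi 0) := fun y δ hδ =>
    integrableOn_invExpKernel_smul (hcont y) (fun r hr => hbdd r hr y) hδ hs
  obtain ⟨hp, hAp⟩ := hR x
  have hRT : ∀ r, 0 ≤ r → R (T r x) = T r (R x) := by
    intro r hr
    have h := hRinv ⟨T r (R x), hmem ⟨R x, hp⟩ r hr⟩
    rwa [hcomm ⟨R x, hp⟩ r hr, ← map_add, hAp] at h
  have hRI : ∀ {δ : ℂ}, δ.re < -1 → R (invExpIntegral (fun r => T r x) δ s) =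
      invExpIntegral (fun r => T r (R x)) δ s := by
    intro δ hδ
    rw [invExpIntegral, ← R.integral_comp_comm (hint x hδ)]
    refine setIntegral_congr_fun measurableSet_Ioi fun r hr => ?_
    have hr : 0 < r := hr
    simp only [map_smul, hRT r hr.le]
  have hparts := invExpIntegral_add_smul_of_hasDerivAt (hcont (R x))
    (fun r hr => hbdd r hr _) (S' := fun r => -T r (A ⟨R x, hp⟩)) (hcont _).neg
    (fun r hr => by rw [norm_neg]; exact hbdd r hr _)
    (fun r hr => hderiv ⟨R x, hp⟩ r hr.le) hβ hs
  have hneg : invExpIntegral (fun r => -T r (A ⟨R x, hp⟩)) β s =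
      -invExpIntegral (fun r => T r (A ⟨R x, hp⟩)) β s := by
    simp only [invExpIntegral, smul_neg, integral_neg]
  have hsum : invExpIntegral (fun r => T r (A ⟨R x, hp⟩)) β s +
      invExpIntegral (fun r => T r (R x)) β s = invExpIntegral (fun r => T r x) β s := by
    rw [invExpIntegral, invExpIntegral, ← integral_add (hint _ hβ) (hint _ hβ)]
    simp only [← smul_add, ← map_add, hAp, invExpIntegral]
  set w := invExpIntegral (fun r => T r x) β s with hw
  set v := β • invExpIntegral (fun r => T r x) (β - 1) s +
    (s : ℂ) • invExpIntegral (fun r => T r x) (β - 2) s with hv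
  have hRw : R (v + w) = w := by
    rw [hv, map_add, map_add, map_smul, map_smul, hRI hβ1, hRI hβ2, hw, hRI hβ, hparts, hneg,
      neg_neg, hsum]
  obtain ⟨h, hA⟩ := hR (v + w)
  have e : (⟨R (v + w), h⟩ : A.domain) = ⟨w, hRw ▸ h⟩ := Subtype.ext hRw
  rw [e] at hA
  exact ⟨hRw ▸ h, add_right_cancel (hA.trans (congrArg (v + ·) hRw.symm))⟩

end

/-- `A` non-negative in a Banach space `X`, `-A_D` generating a bounded `C₀`-semigroup
`(T(t))` on `D := closure D(A)`.  For every `x ∈ D` the harmonic extension `u(t) = U(t)x`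
is a solution of `u'' + ((1-2α)/t)u' = Au` on `(0,∞)` with `u(0) = x`: it is bounded and
continuous on `[0,∞)` with values in `D`, twice continuously differentiable on `(0,∞)`,
`u(t) ∈ D(A)` for `t > 0`, and the ODE holds. -/
theorem stmt9 {X : Type*} [NormedAddCommGroup X] [NormedSpace ℂ X] [CompleteSpace X]
    (A : X →ₗ.[ℂ] X) (R : ℝ → X →L[ℂ] X) (M : ℝ)
    (α : ℂ) (h0 : 0 < α.re) (h1 : α.re < 1)
    (hR : ∀ l : ℝ, 0 < l → ∀ y : X,
      ∃ h : R l y ∈ A.domain, A ⟨R l y, h⟩ + (l : ℂ) • R l y = y)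
    (hRinv : ∀ l : ℝ, 0 < l → ∀ x : A.domain, R l (A x + (l : ℂ) • (x : X)) = x)
    (hM : ∀ l : ℝ, 0 < l → ‖(l : ℂ) • R l‖ ≤ M)
    (T : ℝ → X →L[ℂ] X)
    (hTD : ∀ t : ℝ, 0 ≤ t → ∀ y ∈ closure (A.domain : Set X),
      T t y ∈ closure (A.domain : Set X))
    (hT0 : ∀ y ∈ closure (A.domain : Set X), T 0 y = y)
    (hsemi : ∀ s t : ℝ, 0 ≤ s → 0 ≤ t → ∀ y ∈ closure (A.domain : Set X),
      T (s + t) y = T s (T t y))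
    (hcont : ∀ y ∈ closure (A.domain : Set X), ContinuousOn (fun t => T t y) (Ici 0))
    (hbdd : ∀ t : ℝ, 0 ≤ t → ∀ y ∈ closure (A.domain : Set X), ‖T t y‖ ≤ M * ‖y‖)
    (hgen : ∀ x : A.domain, ∀ t : ℝ, 0 ≤ t →
      ∃ hm : T t (x : X) ∈ A.domain,
        HasDerivAt (fun s => T s (x : X)) (-(A ⟨T t (x : X), hm⟩)) t)
    (x : X) (hx : x ∈ closure (A.domain : Set X)) (u : ℝ → X) (hu0 : u 0 = x)
    (hut : ∀ t : ℝ, 0 < t → u t = (1 / Complex.Gamma α) •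
      ((((t : ℂ) / 2) ^ (2 * α)) •
        ∫ r in Ioi (0:ℝ),
          (((r : ℂ) ^ (-α - 1)) * (Real.exp (-(t ^ 2) / (4 * r)) : ℂ)) • T r x)) :
    ContinuousOn u (Ici 0) ∧ (∃ C : ℝ, ∀ t : ℝ, 0 ≤ t → ‖u t‖ ≤ C) ∧
      (∀ t : ℝ, 0 ≤ t → u t ∈ closure (A.domain : Set X)) ∧
      ContDiffOn ℝ 2 u (Ioi 0) ∧
      ∀ t : ℝ, 0 < t → ∃ h : u t ∈ A.domain,
        deriv (deriv u) t + ((1 - 2 * α) / (t : ℂ)) • deriv u t = A ⟨u t, h⟩ := by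
  have hall : ∀ y : X, y ∈ closure (A.domain : Set X) := by
    intro y
    obtain ⟨h, e⟩ := hR 1 one_pos y
    have h1 := mem_closure_domain_of_hasDerivAt hTD hT0 hgen ⟨R 1 y, h⟩
    have h2 : R 1 y ∈ closure (A.domain : Set X) := subset_closure h
    rw [← Submodule.topologicalClosure_coe] at h1 h2 ⊢
    rw [← e]
    exact add_mem h1 (Submodule.smul_mem _ _ h2)
  have hmem : ∀ x : A.domain, ∀ t : ℝ, 0 ≤ t → T t (x : X) ∈ A.domain :=
    fun x t ht => (hgen x t ht).1
  have hcomm := fun (x : A.domain) (t : ℝ) (ht : 0 ≤ t) =>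
    apply_semigroup_eq_semigroup_apply hT0 hsemi hgen x ht (hmem x t ht)
  have hderiv : ∀ x : A.domain, ∀ t : ℝ, 0 ≤ t →
      HasDerivAt (fun s => T s (x : X)) (-T t (A x)) t := by
    intro x t ht
    obtain ⟨_, hd⟩ := hgen x t ht
    rwa [hcomm x t ht] at hd
  have hS : ContinuousOn (fun r => T r x) (Ici 0) := hcont x hx
  have hC : ∀ r : ℝ, 0 ≤ r → ‖T r x‖ ≤ M * ‖x‖ := fun r hr => hbdd r hr x hx
  have hβ : (-α - 1).re < -1 := by simp; linarith
  have hutI : ∀ t : ℝ, 0 < t → u t = (1 / Complex.Gamma α) • ((((t : ℂ) / 2) ^ (2 * α)) •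
      invExpIntegral (fun r => T r x) (-α - 1) (t ^ 2 / 4)) := by
    intro t ht
    have e (r : ℝ) : -(t ^ 2) / (4 * r) = -(t ^ 2 / 4) / r := by rw [← neg_div, div_div]
    simp only [hut t ht, invExpIntegral, invExpKernel, e]
  have hΓ : Complex.Gamma α ≠ 0 := Complex.Gamma_ne_zero_of_re_pos h0
  have hsub : ∀ t : ℝ, 0 ≤ t → u t = (1 / Complex.Gamma α) •
      ∫ ρ in Ioi (0 : ℝ), ((Real.exp (-ρ) : ℂ) * (ρ : ℂ) ^ (α - 1)) • T (t ^ 2 / 4 / ρ) x := by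
    intro t ht
    rcases ht.eq_or_lt with rfl | ht
    · simp only [ne_eq, OfNat.ofNat_ne_zero, not_false_eq_true, zero_pow, zero_div, hT0 x hx]
      rw [integral_smul_const, ← Complex.GammaIntegral, ← Complex.Gamma_eq_integral h0,
        smul_smul, one_div_mul_cancel hΓ, one_smul, hu0]
    · rw [hutI t ht, invExpIntegral_eq_gamma_subordination _ _ (by positivity),
        smul_smul (((t : ℂ) / 2) ^ (2 * α))]
      have ht2 : ((t / 2 : ℝ) : ℂ) ≠ 0 := by exact_mod_cast (half_pos ht).ne'
      have e : ((t : ℂ) / 2) ^ (2 * α) * ((t ^ 2 / 4 : ℝ) : ℂ) ^ (-α) = 1 := by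
        have h1 : (t ^ 2 / 4 : ℝ) = t / 2 * (t / 2) := by ring
        have h2 : (t : ℂ) / 2 = ((t / 2 : ℝ) : ℂ) := by push_cast; rfl
        rw [h1, h2, Complex.ofReal_mul, Complex.mul_cpow_ofReal_nonneg (by positivity)
          (by positivity), ← Complex.cpow_add _ _ ht2, ← Complex.cpow_add _ _ ht2,
          show 2 * α + (-α + -α) = 0 by ring, Complex.cpow_zero]
      rw [e, one_smul]
  have hbound : ∀ t : ℝ, 0 ≤ t → ∀ᵐ ρ ∂(volume.restrict (Ioi (0 : ℝ))),
      ‖((Real.exp (-ρ) : ℂ) * (ρ : ℂ) ^ (α - 1)) • T (t ^ 2 / 4 / ρ) x‖ ≤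
        Real.exp (-ρ) * ρ ^ (α.re - 1) * (M * ‖x‖) := by
    intro t ht
    filter_upwards [ae_restrict_mem measurableSet_Ioi] with ρ hρ
    have hρ : 0 < ρ := hρ
    rw [norm_smul, norm_mul, Complex.norm_cpow_eq_rpow_re_of_pos hρ, Complex.norm_real,
      Real.norm_of_nonneg (Real.exp_pos _).le, Complex.sub_re, Complex.one_re]
    gcongr
    exact hC _ (by positivity)
  have hboundI : IntegrableOn (fun ρ => Real.exp (-ρ) * ρ ^ (α.re - 1) * (M * ‖x‖)) (Ioi 0) :=
    (Real.GammaIntegral_convergent h0).mul_const _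
  have hform : EqOn u (fun t : ℝ => ((1 / Complex.Gamma α) * ((1 / 2 : ℝ) : ℂ) ^ (2 * α)) •
      ((t : ℂ) ^ (2 * α) • invExpIntegral (fun r => T r x) (-α - 1) (t ^ 2 / 4))) (Ioi 0) := by
    intro t ht
    have ht : 0 < t := ht
    have h2 : (t : ℂ) / 2 = ((1 / 2 : ℝ) : ℂ) * (t : ℂ) := by push_cast; ring
    simp only [hutI t ht, h2, smul_smul]
    rw [Complex.mul_cpow_ofReal_nonneg (by norm_num) ht.le, ← mul_assoc]
  refine ⟨?_, ?_, fun t _ => hall _, ?_, ?_⟩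
  · refine ContinuousOn.congr (ContinuousOn.const_smul ?_ (1 / Complex.Gamma α)) hsub
    refine continuousOn_of_dominated (fun t ht => ?_) hbound hboundI ?_
    · refine ContinuousOn.aestronglyMeasurable (fun ρ hρ => ?_) measurableSet_Ioi
      have hρ : 0 < ρ := hρ
      have ht : 0 ≤ t := ht
      refine ContinuousWithinAt.smul (ContinuousAt.continuousWithinAt (ContinuousAt.mul ?_ ?_)) ?_
      · fun_prop
      · exact Complex.continuousAt_ofReal_cpow_const _ _ (Or.inr hρ.ne')
      · have h1 : ContinuousWithinAt (fun ρ : ℝ => t ^ 2 / 4 / ρ) (Ioi 0) ρ :=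
          (continuousAt_const.div continuousAt_id hρ.ne').continuousWithinAt
        exact ContinuousWithinAt.comp (t := Ici (0 : ℝ)) (g := fun r => T r x)
          (hS _ (by simp only [mem_Ici]; positivity)) h1
          (fun r hr => by have hr : 0 < r := hr; simp only [mem_Ici]; positivity)
    · filter_upwards [ae_restrict_mem measurableSet_Ioi] with ρ hρ
      have hρ : 0 < ρ := hρ
      refine ContinuousOn.const_smul ?_ _
      exact ContinuousOn.comp (t := Ici (0 : ℝ)) (g := fun r => T r x) hS (by fun_prop)
        (fun r hr => by simp only [mem_Ici]; positivity)
  · refine ⟨‖1 / Complex.Gamma α‖ *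
      ∫ ρ in Ioi (0 : ℝ), Real.exp (-ρ) * ρ ^ (α.re - 1) * (M * ‖x‖), fun t ht => ?_⟩
    rw [hsub t ht, norm_smul]
    gcongr
    exact norm_integral_le_of_norm_le hboundI (hbound t ht)
  · exact ((contDiffOn_cpow_smul_invExpIntegral hS hC 2 (2 * α) hβ).const_smul _).congr hform
  · intro t ht
    obtain ⟨hw, hAw⟩ := apply_invExpIntegral_orbit (R := R 1) (A := A) (T := T)
      (fun y => by simpa using hR 1 one_pos y) (fun y => by simpa using hRinv 1 one_pos y)
      (fun y => hcont y (hall y)) (fun t ht y => hbdd t ht y (hall y)) hmem hcomm hderiv hβ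
      (by positivity : 0 < t ^ 2 / 4) x
    set c := (1 / Complex.Gamma α) * ((1 / 2 : ℝ) : ℂ) ^ (2 * α)
    set f := fun t : ℝ =>
      (t : ℂ) ^ (2 * α) • invExpIntegral (fun r => T r x) (-α - 1) (t ^ 2 / 4)
    have hd : EqOn (deriv u) (c • deriv f) (Ioi 0) := fun t ht =>
      (hform.deriv isOpen_Ioi ht).trans (deriv_const_smul_field c f)
    have hdd : deriv (deriv u) t = c • deriv (deriv f) t :=
      (hd.deriv isOpen_Ioi ht).trans (deriv_const_smul_field c _)
    have huw : u t = c • (t : ℂ) ^ (2 * α) •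
        invExpIntegral (fun r => T r x) (-α - 1) (t ^ 2 / 4) := hform ht
    have hut_mem : u t ∈ A.domain := by
      rw [huw]
      exact A.domain.smul_mem _ (A.domain.smul_mem _ hw)
    have hAu : A ⟨u t, hut_mem⟩ = c • (t : ℂ) ^ (2 * α) • A ⟨_, hw⟩ := by
      rw [← A.map_smul, ← A.map_smul]
      exact congrArg A (Subtype.ext huw)
    refine ⟨hut_mem, ?_⟩
    rw [hAu, hAw, hdd, hd ht, Pi.smul_apply, smul_comm _ c, ← smul_add,
      deriv_deriv_cpow_smul_invExpIntegral hS hC h0 ht]
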